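/- arXiv:1608.07038 — 9 statements merged into one kernel-verified Lean document; each statement's English description precedes it below -/
import Mathlib

section
/- Let 𝔽 be a field, let X and Y be finite sets, and let f : X × Y → {0,1}. Suppose (x_1,y_1), …, (x_n,y_n) ∈ X × Y is a fooling set of size n for f. Then for every X×Y matrix A over 𝔽 satisfying A_{x,y} = 0 if and only if f(x,y) = 0, one has n ≤ (rank_𝔽 A)². In particular, no fooling set in f is larger than the square of the minimum of rank_𝔽(A) over all such matrices A. -/
/-- A matrix over a field factors through `Fin A.rank`. -/
theorem Matrix.exists_eq_mul_of_rank {K m n : Type*} [Field K] [Fintype n]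
    (A : Matrix m n K) :
    ∃ (B : Matrix m (Fin A.rank) K) (C : Matrix (Fin A.rank) n K), A = B * C := by
  classical
  let b : Module.Basis (Fin A.rank) K (LinearMap.range A.mulVecLin) := Module.finBasis K _
  let c : n → LinearMap.range A.mulVecLin := fun j =>
    ⟨A.mulVecLin (Pi.single j 1), LinearMap.mem_range_self _ _⟩
  refine ⟨Matrix.of fun i k => (b k : m → K) i, Matrix.of fun k j => b.repr (c j) k, ?_⟩
  ext i j
  have h := congrArg (fun v : LinearMap.range A.mulVecLin => (v : m → K) i) (b.sum_repr (c j))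
  simp only [Submodule.coe_sum, Submodule.coe_smul, Finset.sum_apply, Pi.smul_apply,
    smul_eq_mul] at h
  have hc : (c j : m → K) i = A i j := by simp [c]
  rw [← hc, ← h, Matrix.mul_apply]
  exact Finset.sum_congr rfl fun k _ => mul_comm _ _

/-- A fooling set of size `n` for `f : X × Y → {0,1}` gives the lower bound
`n ≤ (rank A)²` for every matrix `A` over a field `𝔽` whose zero entries are
exactly the zeros of `f`. -/
theorem fooling_set_le_rank_sq
    (𝔽 : Type*) [Field 𝔽] (X Y : Type*) [Fintype X] [Fintype Y]
    (f : X × Y → Bool) (n : ℕ) (x : Fin n → X) (y : Fin n → Y)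
    (hfool1 : ∀ i, f (x i, y i) = true)
    (hfool0 : ∀ i j, i ≠ j → f (x i, y j) = false ∨ f (x j, y i) = false)
    (A : Matrix X Y 𝔽) (hA : ∀ a b, A a b = 0 ↔ f (a, b) = false) :
    n ≤ A.rank ^ 2 := by
  obtain ⟨B, C, hBC⟩ := A.exists_eq_mul_of_rank
  let P : Matrix (Fin n) (Fin A.rank × Fin A.rank) 𝔽 :=
    Matrix.of fun i p => B (x i) p.1 * C p.2 (y i)
  let Q : Matrix (Fin A.rank × Fin A.rank) (Fin n) 𝔽 :=
    Matrix.of fun p j => C p.1 (y j) * B (x j) p.2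
  have hentry (a : X) (b : Y) : A a b = ∑ k, B a k * C k b := by
    rw [← Matrix.mul_apply, ← hBC]
  have hPQ : P * Q = Matrix.diagonal fun i => A (x i) (y i) * A (x i) (y i) := by
    ext i j
    have hmul : (P * Q) i j = A (x i) (y j) * A (x j) (y i) := by
      rw [hentry (x i), hentry (x j), Finset.sum_mul_sum, Matrix.mul_apply, Fintype.sum_prod_type]
      refine Finset.sum_congr rfl fun k _ => Finset.sum_congr rfl fun l _ => ?_
      simp only [P, Q, Matrix.of_apply]
      ring
    rw [hmul]
    rcases eq_or_ne i j with rfl | hij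
    · rw [Matrix.diagonal_apply_eq]
    · rw [Matrix.diagonal_apply_ne _ hij, mul_eq_zero, hA, hA]
      exact hfool0 i j hij
  have hunit : IsUnit (P * Q) := by
    have hne (i : Fin n) : A (x i) (y i) ≠ 0 := by simp [hA, hfool1]
    rw [hPQ, Matrix.isUnit_iff_isUnit_det, Matrix.det_diagonal, isUnit_iff_ne_zero]
    exact Finset.prod_ne_zero_iff.2 fun i _ => mul_ne_zero (hne i) (hne i)
  calc
    n = (P * Q).rank := by rw [Matrix.rank_of_isUnit _ hunit, Fintype.card_fin]
    _ ≤ P.rank := Matrix.rank_mul_le_left P Q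
    _ ≤ Fintype.card (Fin A.rank × Fin A.rank) := P.rank_le_card_width
    _ = A.rank ^ 2 := by rw [Fintype.card_prod, Fintype.card_fin, sq]
end

section
/- For every field 𝔽 and every sequence p = p(n) ∈ (0,1] with p(n) = O(1/n) (i.e., there is a constant C with p(n) ≤ C/n for all n), there exists a constant c > 0 such that, asymptotically almost surely, the minimum rank over 𝔽 of the random fooling-set pattern R(n,p(n)) is at least c·n. -/
open Filter

/-- A fooling-set pattern: `1`s on the diagonal, and at least one of every pair of
diagonally opposite off-diagonal entries is `0`. -/
def IsFoolingPattern {n : ℕ} (R : Matrix (Fin n) (Fin n) Bool) : Prop :=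
  (∀ k, R k k = true) ∧ ∀ k ℓ, k ≠ ℓ → (R k ℓ = false ∨ R ℓ k = false)

/-- Number of off-diagonal `1`-entries of a pattern. -/
noncomputable def offDiagOnes {n : ℕ} (R : Matrix (Fin n) (Fin n) Bool) : ℕ :=
  Nat.card {q : Fin n × Fin n // q.1 ≠ q.2 ∧ R q.1 q.2 = true}

/-- `R` has density `p`: exactly `⌈p·C(n,2)⌉` off-diagonal `1`-entries. -/
def HasDensity {n : ℕ} (R : Matrix (Fin n) (Fin n) Bool) (p : ℝ) : Prop :=
  offDiagOnes R = ⌈p * (n.choose 2 : ℝ)⌉₊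

/-- Minimum rank over `𝔽` of a matrix with zero-nonzero pattern `R`. -/
noncomputable def minRank (𝔽 : Type*) [Field 𝔽] {n : ℕ}
    (R : Matrix (Fin n) (Fin n) Bool) : ℕ :=
  sInf {r | ∃ M : Matrix (Fin n) (Fin n) 𝔽,
    (∀ k ℓ, M k ℓ ≠ 0 ↔ R k ℓ = true) ∧ M.rank = r}

/-- A graph with at most `K * n` edges on `n` vertices has an independent set of linear size. -/
lemma SimpleGraph.exists_isIndepSet_card_le {V : Type*} [Fintype V] [DecidableEq V]
    (G : SimpleGraph V) [DecidableRel G.Adj] (K : ℕ)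
    (hK : G.edgeFinset.card ≤ K * Fintype.card V) :
    ∃ s : Finset V, G.IsIndepSet s ∧ Fintype.card V ≤ 2 * (4 * K + 1) * s.card := by
  classical
  set L : Finset V := Finset.univ.filter fun v => G.degree v ≤ 4 * K
  set H : Finset V := Finset.univ.filter fun v => ¬ G.degree v ≤ 4 * K
  have hLH : L.card + H.card = Fintype.card V :=
    Finset.card_filter_add_card_filter_not (s := Finset.univ) _
  have hHcard : H.card * (4 * K + 1) ≤ 2 * (K * Fintype.card V) := calc
    H.card * (4 * K + 1) ≤ ∑ v ∈ H, G.degree v := by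
      rw [← smul_eq_mul]
      refine Finset.card_nsmul_le_sum _ _ _ fun v hv => ?_
      have := (Finset.mem_filter.1 hv).2
      omega
    _ ≤ ∑ v, G.degree v := Finset.sum_le_sum_of_subset (Finset.subset_univ _)
    _ ≤ 2 * (K * Fintype.card V) := by
      rw [G.sum_degrees_eq_twice_card_edges]
      omega
  obtain ⟨s, hs⟩ := (Set.toFinite {s : Finset V | s ⊆ L ∧ G.IsIndepSet s}).exists_maximal
    ⟨∅, by simp⟩
  obtain ⟨⟨hsL, hind⟩, hmax⟩ := hs
  have hcover : L ⊆ s.biUnion fun v => insert v (G.neighborFinset v) := by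
    intro u hu
    by_contra hcon
    simp only [Finset.mem_biUnion, Finset.mem_insert, SimpleGraph.mem_neighborFinset,
      not_exists, not_and, not_or] at hcon
    have hus : u ∉ s := fun h => (hcon u h).1 rfl
    have hins : insert u s ∈ {s : Finset V | s ⊆ L ∧ G.IsIndepSet s} := by
      refine ⟨Finset.insert_subset hu hsL, ?_⟩
      rw [Finset.coe_insert, SimpleGraph.isIndepSet_iff, Set.pairwise_insert]
      exact ⟨hind, fun v hv _ => ⟨fun h => (hcon v hv).2 h.symm, (hcon v hv).2⟩⟩
    exact hus (hmax hins (Finset.subset_insert u s) (Finset.mem_insert_self u s))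
  have hLcard : L.card ≤ s.card * (4 * K + 1) := by
    refine (Finset.card_le_card hcover).trans (Finset.card_biUnion_le_card_mul _ _ _ ?_)
    intro v hv
    refine (Finset.card_insert_le _ _).trans ?_
    rw [SimpleGraph.card_neighborFinset_eq_degree]
    have := (Finset.mem_filter.1 (hsL hv)).2
    omega
  refine ⟨s, hind, ?_⟩
  have hH2 : 2 * H.card ≤ Fintype.card V := by nlinarith
  nlinarith

/-- The rank of a matrix is at least the size of any principal submatrix that is diagonal with
nonzero diagonal entries. -/
lemma Matrix.card_le_rank_of_diagonal_on {𝔽 m : Type*} [Field 𝔽] [Fintype m]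
    (M : Matrix m m 𝔽) (s : Finset m) (hdiag : ∀ k ∈ s, M k k ≠ 0)
    (hoff : ∀ k ∈ s, ∀ ℓ ∈ s, k ≠ ℓ → M k ℓ = 0) : s.card ≤ M.rank := by
  classical
  have hsub : M.submatrix ((↑) : s → m) ((↑) : s → m) =
      Matrix.diagonal fun k : s => M k k := by
    ext k ℓ
    by_cases h : k = ℓ
    · subst h
      simp
    · rw [Matrix.diagonal_apply_ne _ h]
      exact hoff k k.2 ℓ ℓ.2 fun h' => h (Subtype.ext h')
  have hrank := Matrix.rank_submatrix_le M ((↑) : s → m) ((↑) : s → m)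
  rw [hsub, Matrix.rank_diagonal] at hrank
  calc s.card = Fintype.card {k : s // M k k ≠ 0} := by
        rw [Fintype.card_congr (Equiv.subtypeUnivEquiv fun k : s => hdiag k k.2),
          Fintype.card_coe]
    _ ≤ M.rank := hrank

/-- The minimum rank is attained. -/
lemma exists_rank_eq_minRank (𝔽 : Type*) [Field 𝔽] {n : ℕ} (R : Matrix (Fin n) (Fin n) Bool) :
    ∃ M : Matrix (Fin n) (Fin n) 𝔽,
      (∀ k ℓ, M k ℓ ≠ 0 ↔ R k ℓ = true) ∧ M.rank = minRank 𝔽 R :=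
  Nat.sInf_mem (s := {r | ∃ M : Matrix (Fin n) (Fin n) 𝔽,
    (∀ k ℓ, M k ℓ ≠ 0 ↔ R k ℓ = true) ∧ M.rank = r})
    ⟨_, Matrix.of fun k ℓ => if R k ℓ = true then 1 else 0, by simp, rfl⟩

/-- A pattern with ones on the diagonal and linearly many off-diagonal ones has linear
minimum rank. -/
lemma le_minRank_of_offDiagOnes_le (𝔽 : Type*) [Field 𝔽] {n : ℕ}
    (R : Matrix (Fin n) (Fin n) Bool) (hR : ∀ k, R k k = true) (K : ℕ)
    (hK : offDiagOnes R ≤ K * n) : n ≤ 2 * (4 * K + 1) * minRank 𝔽 R := by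
  classical
  set G : SimpleGraph (Fin n) := SimpleGraph.fromRel fun k ℓ => R k ℓ = true
  have hedges : G.edgeFinset.card ≤ K * Fintype.card (Fin n) := by
    rw [Fintype.card_fin]
    refine le_trans ?_ hK
    rw [offDiagOnes, Nat.card_eq_fintype_card, Fintype.card_subtype]
    refine (Finset.card_le_card ?_).trans
      (Finset.card_image_le (f := fun q : Fin n × Fin n => s(q.1, q.2)))
    intro e
    induction e with
    | h k ℓ =>
      intro he
      rw [SimpleGraph.mem_edgeFinset, SimpleGraph.mem_edgeSet] at he
      obtain ⟨hne, h | h⟩ := he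
      · exact Finset.mem_image.2 ⟨(k, ℓ), by simp [hne, h], rfl⟩
      · exact Finset.mem_image.2 ⟨(ℓ, k), by simp [hne.symm, h], Sym2.eq_swap⟩
  obtain ⟨s, hind, hs⟩ := G.exists_isIndepSet_card_le K hedges
  rw [Fintype.card_fin] at hs
  obtain ⟨M, hM, hrank⟩ := exists_rank_eq_minRank 𝔽 R
  have hle : s.card ≤ M.rank := by
    refine M.card_le_rank_of_diagonal_on s (fun k _ => (hM k k).2 (hR k)) ?_
    intro k hk ℓ hℓ hne
    by_contra h
    exact hind hk hℓ hne ⟨hne, Or.inl ((hM k ℓ).1 h)⟩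
  rw [hrank] at hle
  exact hs.trans (Nat.mul_le_mul_left _ hle)

lemma Fin.card_filter_fst_lt_snd (n : ℕ) :
    (Finset.univ.filter fun q : Fin n × Fin n => q.1 < q.2).card = n.choose 2 := by
  rw [Finset.card_filter, Fintype.sum_prod_type_right, Nat.choose_two_right,
    ← Finset.sum_range_id, ← Fin.sum_univ_eq_sum_range (fun i => i)]
  refine Finset.sum_congr rfl fun j _ => ?_
  rw [← Finset.card_filter]
  exact (congrArg Finset.card (by ext; simp)).trans (Fin.card_Iio j)

/-- Fooling-set patterns of every density at most one exist. -/
lemma exists_isFoolingPattern_hasDensity (n : ℕ) {p : ℝ} (hp : p ≤ 1) :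
    ∃ R : Matrix (Fin n) (Fin n) Bool, IsFoolingPattern R ∧ HasDensity R p := by
  classical
  have hle : ⌈p * (n.choose 2 : ℝ)⌉₊ ≤
      (Finset.univ.filter fun q : Fin n × Fin n => q.1 < q.2).card := by
    rw [Fin.card_filter_fst_lt_snd]
    exact Nat.ceil_le.2 (mul_le_of_le_one_left (Nat.cast_nonneg _) hp)
  obtain ⟨T, hT, hcard⟩ := Finset.exists_subset_card_eq hle
  have hlt : ∀ k ℓ, (k, ℓ) ∈ T → k < ℓ := fun k ℓ h => (Finset.mem_filter.1 (hT h)).2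
  refine ⟨Matrix.of fun k ℓ => decide (k = ℓ ∨ (k, ℓ) ∈ T), ⟨by simp, ?_⟩, ?_⟩
  · intro k ℓ hne
    simp only [Matrix.of_apply, decide_eq_false_iff_not, not_or]
    by_cases h : (k, ℓ) ∈ T
    · exact Or.inr ⟨hne.symm, fun h' => (hlt _ _ h).asymm (hlt _ _ h')⟩
    · exact Or.inl ⟨hne, h⟩
  · rw [HasDensity, offDiagOnes, ← hcard, Nat.card_eq_fintype_card, Fintype.card_subtype]
    congr 1
    ext ⟨k, ℓ⟩
    simp only [Matrix.of_apply, decide_eq_true_eq, Finset.mem_filter, Finset.mem_univ, true_and]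
    exact ⟨fun h => h.2.resolve_left h.1, fun h => ⟨(hlt _ _ h).ne, Or.inr h⟩⟩

/-- A density `O(1/n)` means linearly many off-diagonal ones. -/
lemma offDiagOnes_le_of_hasDensity {n K : ℕ} (hn : 0 < n) {p C : ℝ} (hp : p ≤ C / n)
    (hC : |C| + 1 ≤ K) {R : Matrix (Fin n) (Fin n) Bool} (hR : HasDensity R p) :
    offDiagOnes R ≤ K * n := by
  have hn' : (1 : ℝ) ≤ n := by exact_mod_cast hn
  rw [show offDiagOnes R = _ from hR, Nat.ceil_le]
  have hchoose : (n.choose 2 : ℝ) ≤ n * n := by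
    rw [Nat.cast_choose_two]
    nlinarith
  have hpC : p ≤ |C| / n := hp.trans (by gcongr; exact le_abs_self C)
  calc p * (n.choose 2 : ℝ) ≤ |C| / n * (n * n) := by gcongr
    _ = |C| * n := by field_simp
    _ ≤ ((K * n : ℕ) : ℝ) := by
      push_cast
      gcongr
      linarith

/-- Theorem 1(a): if `p(n) = O(1/n)`, then a.a.s. the minimum rank of
`R(n,p)` over any field is `Ω(n)`. -/
theorem minRank_aas_linear_of_small_density
    (𝔽 : Type*) [Field 𝔽] (p : ℕ → ℝ)
    (hp0 : ∀ n, 0 < p n) (hp1 : ∀ n, p n ≤ 1)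
    (hbig : ∃ C : ℝ, ∀ n : ℕ, 0 < n → p n ≤ C / n) :
    ∃ c : ℝ, 0 < c ∧
      Tendsto (fun n : ℕ =>
          (Nat.card {R : Matrix (Fin n) (Fin n) Bool //
              IsFoolingPattern R ∧ HasDensity R (p n) ∧
              c * n ≤ (minRank 𝔽 R : ℝ)} : ℝ) /
          (Nat.card {R : Matrix (Fin n) (Fin n) Bool //
              IsFoolingPattern R ∧ HasDensity R (p n)} : ℝ))
        atTop (nhds 1) := by
  obtain ⟨C, hC⟩ := hbig
  obtain ⟨K, hK⟩ := exists_nat_ge (|C| + 1)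
  have hpos : (0 : ℝ) < 2 * (4 * K + 1) := by positivity
  refine ⟨(2 * (4 * K + 1))⁻¹, inv_pos.2 hpos, ?_⟩
  refine tendsto_const_nhds.congr' ?_
  filter_upwards [eventually_gt_atTop 0] with n hn
  have hall : ∀ R : Matrix (Fin n) (Fin n) Bool,
      (IsFoolingPattern R ∧ HasDensity R (p n) ∧
        (2 * (4 * K + 1) : ℝ)⁻¹ * n ≤ (minRank 𝔽 R : ℝ)) ↔
      IsFoolingPattern R ∧ HasDensity R (p n) := by
    refine fun R => ⟨fun h => ⟨h.1, h.2.1⟩, fun h => ⟨h.1, h.2, ?_⟩⟩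
    rw [inv_mul_le_iff₀ hpos]
    exact_mod_cast le_minRank_of_offDiagOnes_le 𝔽 R h.1.1 K
      (offDiagOnes_le_of_hasDensity hn (hC n hn) hK h.2)
  rw [Nat.card_congr (Equiv.subtypeEquivRight hall), div_self]
  obtain ⟨R, hR⟩ := exists_isFoolingPattern_hasDensity n (hp1 n)
  have : Nonempty {R : Matrix (Fin n) (Fin n) Bool //
      IsFoolingPattern R ∧ HasDensity R (p n)} := ⟨⟨R, hR⟩⟩
  exact_mod_cast Nat.card_pos.ne'
end

section
/- For every field 𝔽 and every constant p ∈ (0,1], there exists a constant c > 0 such that, asymptotically almost surely, the minimum rank over 𝔽 of the random fooling-set pattern R(n,p) is at least c·n. -/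
open Filter

/-- Over `n` variables there are at most `(n + D).choose D` monomials of degree at most `D`. -/
theorem card_finsupp_degree_le (σ : Type*) [Fintype σ] (D : ℕ) :
    Nat.card {d : σ →₀ ℕ // (d.sum fun _ e => e) ≤ D} ≤ (Fintype.card σ + D).choose D := by
  classical
  have hcard (d : σ →₀ ℕ) : d.toMultiset.card = d.sum fun _ e => e := Finsupp.card_toMultiset d
  let f : {d : σ →₀ ℕ // (d.sum fun _ e => e) ≤ D} → Sym (Option σ) D := fun d =>
    ⟨d.1.toMultiset.map some + Multiset.replicate (D - d.1.sum fun _ e => e) none, by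
      have := d.2
      simp only [Multiset.card_add, Multiset.card_map, hcard, Multiset.card_replicate]
      omega⟩
  have hf : Function.Injective f := by
    intro d e h
    have h' := congrArg (fun s : Sym (Option σ) D => (s : Multiset (Option σ)).filterMap id) h
    have key (g : {d : σ →₀ ℕ // (d.sum fun _ e => e) ≤ D}) :
        (f g : Multiset (Option σ)).filterMap id = g.1.toMultiset := by
      simp only [f, Sym.coe_mk, Multiset.filterMap_add, Multiset.filterMap_map]
      have h0 (k : ℕ) : (Multiset.replicate k (none : Option σ)).filterMap id = 0 := by
        induction k with
        | zero => simp
        | succ k ih => simp [Multiset.replicate_succ, ih]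
      rw [h0, add_zero]
      exact Multiset.filterMap_some _
    simp only [key] at h'
    exact Subtype.ext (Multiset.toFinsupp.symm.injective h')
  calc _ ≤ Nat.card (Sym (Option σ) D) := Nat.card_le_card_of_injective f hf
    _ = _ := by
      rw [Nat.card_eq_fintype_card, Sym.card_sym_eq_choose, Fintype.card_option]
      congr 1
      omega

theorem finrank_restrictTotalDegree_le (𝔽 : Type*) [Field 𝔽] (σ : Type*) [Fintype σ] (D : ℕ) :
    Module.finrank 𝔽 (MvPolynomial.restrictTotalDegree σ 𝔽 D) ≤
      (Fintype.card σ + D).choose D := by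
  unfold MvPolynomial.restrictTotalDegree
  rw [Module.finrank_eq_nat_card_basis (MvPolynomial.basisRestrictSupport 𝔽 _)]
  exact card_finsupp_degree_le σ D

/-- The zero-pattern theorem of Rónyai, Babai and Ganapathy: a finite family of polynomials of
degree at most `d` realizes at most as many zero-patterns as there are monomials of degree at most
`d` times the size of the family. -/
theorem card_zeroPattern_le {𝔽 : Type*} [Field 𝔽] {σ ι : Type*} [Fintype σ] [Fintype ι]
    (f : ι → MvPolynomial σ 𝔽) (d : ℕ) (hf : ∀ j, (f j).totalDegree ≤ d) :
    Nat.card {S : Finset ι // ∃ v : σ → 𝔽, ∀ j, j ∈ S ↔ MvPolynomial.eval v (f j) ≠ 0} ≤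
      (Fintype.card σ + Fintype.card ι * d).choose (Fintype.card ι * d) := by
  classical
  set P := {S : Finset ι // ∃ v : σ → 𝔽, ∀ j, j ∈ S ↔ MvPolynomial.eval v (f j) ≠ 0}
  choose v hv using fun S : P => S.2
  let g : P → MvPolynomial.restrictTotalDegree σ 𝔽 (Fintype.card ι * d) := fun S =>
    ⟨∏ j ∈ S.1, f j, by
      rw [MvPolynomial.mem_restrictTotalDegree]
      calc (∏ j ∈ S.1, f j).totalDegree ≤ ∑ j ∈ S.1, (f j).totalDegree :=
            MvPolynomial.totalDegree_finsetProd _ _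
        _ ≤ S.1.card * d := by
            simpa using Finset.sum_le_card_nsmul S.1 _ d fun j _ => hf j
        _ ≤ Fintype.card ι * d := Nat.mul_le_mul_right _ (Finset.card_le_univ _)⟩
  have hg (S T : P) : MvPolynomial.eval (v T) (g S).1 ≠ 0 ↔ S.1 ⊆ T.1 := by
    simp only [g, map_prod, Finset.prod_ne_zero_iff, Finset.subset_iff, hv]
  have hli : LinearIndependent 𝔽 g := by
    rw [Fintype.linearIndependent_iff]
    intro c hc
    have key : ∀ (A : Finset ι) (T : P), T.1 = A → c T = 0 := by
      intro A
      induction A using Finset.strongInduction with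
      | H A ih =>
        rintro T rfl
        have h := congrArg (fun q => MvPolynomial.eval (v T) (Subtype.val q)) hc
        simp only [Submodule.coe_sum, Submodule.coe_smul, map_sum, MvPolynomial.smul_eval,
          ZeroMemClass.coe_zero, map_zero] at h
        rw [Finset.sum_eq_single T] at h
        · exact (mul_eq_zero.mp h).resolve_right ((hg T T).2 subset_rfl)
        · intro S _ hST
          by_cases hsub : S.1 ⊆ T.1
          · rw [ih S.1 (hsub.ssubset_of_ne fun h => hST (Subtype.ext h)) S rfl, zero_mul]
          · rw [not_ne_iff.mp (mt (hg S T).1 hsub), mul_zero]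
        · simp
    exact fun S => key S.1 S rfl
  calc Nat.card P = Fintype.card P := Nat.card_eq_fintype_card
    _ ≤ Module.finrank 𝔽 (MvPolynomial.restrictTotalDegree σ 𝔽 (Fintype.card ι * d)) :=
      hli.fintype_card_le_finrank
    _ ≤ _ := finrank_restrictTotalDegree_le 𝔽 σ _

theorem exists_mul_eq_of_rank_le {𝔽 : Type*} [Field 𝔽] {n r : ℕ} (M : Matrix (Fin n) (Fin n) 𝔽)
    (hr : M.rank ≤ r) :
    ∃ (X : Matrix (Fin n) (Fin r) 𝔽) (Y : Matrix (Fin r) (Fin n) 𝔽), X * Y = M := by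
  classical
  have hle : Module.rank 𝔽 (LinearMap.range M.toLin') ≤ Module.rank 𝔽 (Fin r → 𝔽) := by
    rw [← Module.finrank_eq_rank, ← Module.finrank_eq_rank, Module.finrank_fin_fun]
    exact_mod_cast hr
  obtain ⟨g, hg⟩ := (rank_le_iff_exists_linearMap ..).1 hle
  obtain ⟨h, hh⟩ := g.exists_leftInverse_of_injective (LinearMap.ker_eq_bot.2 hg)
  refine ⟨LinearMap.toMatrix' ((LinearMap.range M.toLin').subtype ∘ₗ h),
    LinearMap.toMatrix' (g ∘ₗ M.toLin'.rangeRestrict), ?_⟩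
  rw [← LinearMap.toMatrix'_comp, LinearMap.comp_assoc, ← LinearMap.comp_assoc _ g h, hh,
    LinearMap.id_comp, LinearMap.subtype_comp_codRestrict, LinearMap.toMatrix'_toLin']

/-- The patterns of `n × n` matrices of rank at most `r` are zero-patterns of `n ^ 2` quadratic
polynomials in `2 * n * r` variables. -/
theorem card_rank_le_pattern (𝔽 : Type*) [Field 𝔽] (n r : ℕ) :
    Nat.card {R : Matrix (Fin n) (Fin n) Bool // ∃ M : Matrix (Fin n) (Fin n) 𝔽,
      (∀ k ℓ, M k ℓ ≠ 0 ↔ R k ℓ = true) ∧ M.rank ≤ r} ≤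
      (2 * n * r + 2 * n ^ 2).choose (2 * n ^ 2) := by
  classical
  let f : Fin n × Fin n → MvPolynomial ((Fin n × Fin r) ⊕ (Fin r × Fin n)) 𝔽 := fun q =>
    ∑ i, MvPolynomial.X (Sum.inl (q.1, i)) * MvPolynomial.X (Sum.inr (i, q.2))
  have hf (q) : (f q).totalDegree ≤ 2 := by
    refine MvPolynomial.totalDegree_finsetSum_le fun i _ => ?_
    refine (MvPolynomial.totalDegree_mul _ _).trans ?_
    simp
  have h := card_zeroPattern_le f 2 hf
  have e1 : Fintype.card ((Fin n × Fin r) ⊕ (Fin r × Fin n)) = 2 * n * r := by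
    simp; ring
  have e2 : Fintype.card (Fin n × Fin n) * 2 = 2 * n ^ 2 := by
    simp; ring
  rw [e1, e2] at h
  refine le_trans ?_ h
  refine Nat.card_le_card_of_injective
    (fun R => ⟨Finset.univ.filter fun q => R.1 q.1 q.2 = true, ?_⟩) ?_
  · obtain ⟨M, hM, hr⟩ := R.2
    obtain ⟨X, Y, rfl⟩ := exists_mul_eq_of_rank_le M hr
    refine ⟨Sum.elim (fun q => X q.1 q.2) (fun q => Y q.1 q.2), fun q => ?_⟩
    simp only [Finset.mem_filter, Finset.mem_univ, true_and, ← hM]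
    simp only [f, map_sum, map_mul, MvPolynomial.eval_X, Sum.elim_inl, Sum.elim_inr,
      Matrix.mul_apply]
  · intro R S hRS
    ext k ℓ
    have := congrArg (fun A => (k, ℓ) ∈ A.1) hRS
    rw [Bool.eq_iff_iff]
    simpa only [Finset.mem_filter, Finset.mem_univ, true_and, eq_iff_iff] using this

theorem choose_mul_pow_le_exp (N D : ℕ) {x : ℝ} (hx : 0 ≤ x) :
    ((N + D).choose D : ℝ) * x ^ N ≤ Real.exp (x * (N + D)) := by
  calc ((N + D).choose D : ℝ) * x ^ N = x ^ N * 1 ^ (N + D - N) * (N + D).choose N := by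
        rw [one_pow, ← Nat.choose_symm_add]; ring
    _ ≤ (x + 1) ^ (N + D) := by
        rw [add_pow]
        exact Finset.single_le_sum
          (f := fun i => x ^ i * 1 ^ (N + D - i) * ((N + D).choose i : ℝ))
          (fun i _ => by positivity) (Finset.mem_range.2 (by omega))
    _ ≤ Real.exp x ^ (N + D) := by gcongr; exact Real.add_one_le_exp x
    _ = _ := by rw [← Real.exp_nat_mul]; push_cast; ring_nf

theorem two_pow_le_card_foolingPattern {n m : ℕ} (hm : m ≤ n.choose 2) :
    2 ^ m ≤ Nat.card {R : Matrix (Fin n) (Fin n) Bool //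
      IsFoolingPattern R ∧ offDiagOnes R = m} := by
  classical
  let E : Finset (Fin n × Fin n) := Finset.univ.filter fun q => q.1 < q.2
  have hE : E.card = n.choose 2 := by
    rw [Finset.card_filter, Fintype.sum_prod_type_right]
    simp only [← Finset.card_filter, Finset.filter_gt_eq_Iio, Fin.card_Iio]
    rw [Fin.sum_univ_eq_sum_range (fun i => i), Finset.sum_range_id, Nat.choose_two_right]
  obtain ⟨A, hAE, hA⟩ := Finset.exists_subset_card_eq (hm.trans hE.ge)
  have hlt {k ℓ} (h : (k, ℓ) ∈ A) : k < ℓ := by simpa [E] using hAE h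
  have hcard : Nat.card A.powerset = 2 ^ m := by
    rw [Nat.card_eq_fintype_card, Fintype.card_coe, Finset.card_powerset, hA]
  rw [← hcard]
  refine Nat.card_le_card_of_injective (fun B =>
    ⟨fun k ℓ => decide (k = ℓ ∨ (k, ℓ) ∈ B.1 ∨ (ℓ, k) ∈ A \ B.1), ⟨by simp, ?_⟩, ?_⟩) ?_
  · have hB := Finset.mem_powerset.1 B.2
    intro k ℓ hne
    have h1 := @hlt k ℓ
    have h2 := @hlt ℓ k
    have h3 := @hB (k, ℓ)
    have h4 := @hB (ℓ, k)
    by_contra! hcon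
    simp [hne, hne.symm] at hcon
    grind
  · have hB := Finset.mem_powerset.1 B.2
    let e : A → {q : Fin n × Fin n // q.1 ≠ q.2 ∧
        decide (q.1 = q.2 ∨ (q.1, q.2) ∈ B.1 ∨ (q.2, q.1) ∈ A \ B.1) = true} := fun a =>
      if h : a.1 ∈ B.1 then ⟨a.1, (hlt a.2).ne, by simp [h]⟩
      else ⟨a.1.swap, (hlt a.2).ne', by simp [h]⟩
    have he : Function.Bijective e := by
      constructor
      · rintro ⟨⟨i, j⟩, ha⟩ ⟨⟨k, ℓ⟩, hb⟩ hab
        have h1 := hlt ha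
        have h2 := hlt hb
        have hab := congrArg Subtype.val hab
        simp only [e] at hab
        split_ifs at hab <;> simp at hab ⊢ <;> grind
      · rintro ⟨⟨k, ℓ⟩, hne, hq⟩
        simp only [decide_eq_true_eq, Finset.mem_sdiff] at hne hq
        rcases hq with h | h | ⟨h, h'⟩
        · exact absurd h hne
        · exact ⟨⟨(k, ℓ), hB h⟩, by simp [e, h]⟩
        · exact ⟨⟨(ℓ, k), h⟩, by simp [e, h']⟩
    unfold offDiagOnes
    rw [← Nat.card_eq_of_bijective e he, Nat.card_eq_fintype_card, Fintype.card_coe, hA]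
  · intro B C hBC
    ext ⟨k, ℓ⟩
    have hB := Finset.mem_powerset.1 B.2
    have hC := Finset.mem_powerset.1 C.2
    have := congrFun (congrFun (congrArg Subtype.val hBC) k) ℓ
    simp at this
    have h1 := @hlt k ℓ
    have h2 := @hlt ℓ k
    have h3 := @hB (k, ℓ)
    have h4 := @hC (k, ℓ)
    grind

theorem card_and_add_card_and_not {α : Type*} [Finite α] (A B : α → Prop) :
    Nat.card {x // A x ∧ B x} + Nat.card {x // A x ∧ ¬ B x} = Nat.card {x // A x} := by
  classical
  have := Fintype.ofFinite α
  simp only [Nat.card_eq_fintype_card, Fintype.card_subtype, ← Finset.filter_filter]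
  exact Finset.card_filter_add_card_filter_not _

theorem card_minRank_lt_le (𝔽 : Type*) [Field 𝔽] (n : ℕ) (A : Matrix (Fin n) (Fin n) Bool → Prop)
    (y : ℝ) :
    Nat.card {R : Matrix (Fin n) (Fin n) Bool // A R ∧ ¬ y ≤ (minRank 𝔽 R : ℝ)} ≤
      (2 * n * ⌊y⌋₊ + 2 * n ^ 2).choose (2 * n ^ 2) := by
  refine le_trans (Nat.card_mono (Set.toFinite _) ?_) (card_rank_le_pattern 𝔽 n ⌊y⌋₊)
  rintro R ⟨-, hR⟩
  have hne : {r | ∃ M : Matrix (Fin n) (Fin n) 𝔽,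
      (∀ k ℓ, M k ℓ ≠ 0 ↔ R k ℓ = true) ∧ M.rank = r}.Nonempty :=
    ⟨_, fun k ℓ => if R k ℓ = true then 1 else 0, by simp, rfl⟩
  obtain ⟨M, hM, hr⟩ := Nat.sInf_mem hne
  refine ⟨M, hM, ?_⟩
  rw [hr]
  exact Nat.le_floor (not_le.1 hR).le

/-- For suitable `c`, the patterns of rank below `c * n` number at most `exp (p * n ^ 2 / 4)`. -/
theorem exists_choose_le_exp {p : ℝ} (hp0 : 0 < p) (hp1 : p ≤ 1) :
    ∃ c : ℝ, 0 < c ∧ ∀ n : ℕ,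
      ((2 * n * ⌊c * n⌋₊ + 2 * n ^ 2).choose (2 * n ^ 2) : ℝ) ≤ Real.exp (p * n ^ 2 / 4) := by
  set x : ℝ := p / 32 with hx
  have hx0 : 0 < x := by positivity
  have hlog : Real.log x < 0 := Real.log_neg hx0 (by linarith)
  set L := -Real.log x with hL
  have hL0 : 0 < L := by linarith
  refine ⟨min 1 (p / (16 * L)), by positivity, fun n => ?_⟩
  set c := min 1 (p / (16 * L)) with hc
  have hc0 : 0 < c := by positivity
  have hc1 : c ≤ 1 := min_le_left _ _
  have hcL : c * L ≤ p / 16 := by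
    calc c * L ≤ p / (16 * L) * L := by gcongr; exact min_le_right _ _
      _ = p / 16 := by field_simp
  set r := ⌊c * n⌋₊
  have hr : (r : ℝ) ≤ c * n := Nat.floor_le (by positivity)
  have h := choose_mul_pow_le_exp (2 * n * r) (2 * n ^ 2) hx0.le
  have hpow : x ^ (2 * n * r) = Real.exp (-(L * (2 * n * r))) := by
    calc x ^ (2 * n * r) = Real.exp (Real.log x) ^ (2 * n * r) := by rw [Real.exp_log hx0]
      _ = _ := by
        rw [← Real.exp_nat_mul, hL]
        push_cast
        ring_nf
  rw [hpow, Real.exp_neg, ← div_eq_mul_inv, div_le_iff₀ (Real.exp_pos _), ← Real.exp_add] at h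
  refine h.trans (Real.exp_le_exp.2 ?_)
  push_cast
  have hn : (0 : ℝ) ≤ n := n.cast_nonneg
  have h1 : (n : ℝ) * r ≤ c * n ^ 2 := by nlinarith
  have h2 : (n : ℝ) * r ≤ n ^ 2 := by nlinarith
  have h3 : L * (n * r) ≤ p / 16 * n ^ 2 := by
    calc L * (n * r) ≤ L * (c * n ^ 2) := by gcongr
      _ = c * L * n ^ 2 := by ring
      _ ≤ _ := by gcongr
  have h4 : x * (n * r) ≤ x * n ^ 2 := by gcongr
  rw [hx] at h4 ⊢
  nlinarith

/-- Theorem 1(c): for every field `𝔽` and constant density `p ∈ (0,1]`, a.a.s. the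
minimum rank of `R(n,p)` is `Ω(n)`. -/
theorem minRank_aas_linear_of_constant_density
    (𝔽 : Type*) [Field 𝔽] (p : ℝ) (hp0 : 0 < p) (hp1 : p ≤ 1) :
    ∃ c : ℝ, 0 < c ∧
      Tendsto (fun n : ℕ =>
          (Nat.card {R : Matrix (Fin n) (Fin n) Bool //
              IsFoolingPattern R ∧ HasDensity R p ∧
              c * n ≤ (minRank 𝔽 R : ℝ)} : ℝ) /
          (Nat.card {R : Matrix (Fin n) (Fin n) Bool //
              IsFoolingPattern R ∧ HasDensity R p} : ℝ))
        atTop (nhds 1) := by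
  obtain ⟨c, hc0, hc⟩ := exists_choose_le_exp hp0 hp1
  refine ⟨c, hc0, ?_⟩
  have hlim : Tendsto (fun n : ℕ => 1 - Real.exp (-(p / 2 * n))) atTop (nhds 1) := by
    have h : Tendsto (fun n : ℕ => p / 2 * (n : ℝ)) atTop atTop :=
      tendsto_natCast_atTop_atTop.const_mul_atTop (by positivity)
    simpa using (Real.tendsto_exp_neg_atTop_nhds_zero.comp h).const_sub 1
  refine tendsto_of_tendsto_of_tendsto_of_le_of_le' hlim tendsto_const_nhds ?_ ?_
  · filter_upwards [eventually_ge_atTop 10] with n hn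
    have hn' : (10 : ℝ) ≤ n := by exact_mod_cast hn
    have hsplit := card_and_add_card_and_not
      (fun R : Matrix (Fin n) (Fin n) Bool => IsFoolingPattern R ∧ HasDensity R p)
      (fun R => c * n ≤ (minRank 𝔽 R : ℝ))
    have hbad := card_minRank_lt_le 𝔽 n
      (fun R => IsFoolingPattern R ∧ HasDensity R p) (c * n)
    have hm : ⌈p * (n.choose 2 : ℝ)⌉₊ ≤ n.choose 2 :=
      Nat.ceil_le.2 (mul_le_of_le_one_left (Nat.cast_nonneg _) hp1)
    have htotal := two_pow_le_card_foolingPattern hm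
    simp only [and_assoc] at hsplit hbad
    change _ ≤ Nat.card {R : Matrix (Fin n) (Fin n) Bool //
      IsFoolingPattern R ∧ HasDensity R p} at htotal
    set T := Nat.card {R : Matrix (Fin n) (Fin n) Bool // IsFoolingPattern R ∧ HasDensity R p}
    set B := Nat.card {R : Matrix (Fin n) (Fin n) Bool //
      IsFoolingPattern R ∧ HasDensity R p ∧ ¬ c * n ≤ (minRank 𝔽 R : ℝ)}
    have hB : (B : ℝ) ≤ Real.exp (p * n ^ 2 / 4) := (Nat.cast_le.2 hbad).trans (hc n)
    have hT : Real.exp (0.69 * (p * (n * (n - 1) / 2))) ≤ T := by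
      have hceil := Nat.le_ceil (p * (n.choose 2 : ℝ))
      rw [Nat.cast_choose_two] at hceil
      have hlog2 : 0.69 ≤ Real.log 2 := by linarith [Real.log_two_gt_d9]
      calc _ ≤ Real.exp (Real.log 2 * (⌈p * (n.choose 2 : ℝ)⌉₊ : ℝ)) := by
            rw [Nat.cast_choose_two]
            have : 0 ≤ p * ((n : ℝ) * (n - 1) / 2) := by
              have : (0 : ℝ) ≤ n - 1 := by linarith
              positivity
            gcongr
        _ = 2 ^ ⌈p * (n.choose 2 : ℝ)⌉₊ := by
            rw [mul_comm, Real.exp_nat_mul, Real.exp_log two_pos]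
        _ ≤ T := by exact_mod_cast htotal
    have hT0 : (0 : ℝ) < T := (Real.exp_pos _).trans_le hT
    have hBT : (B : ℝ) ≤ Real.exp (-(p / 2 * n)) * T := by
      calc (B : ℝ) ≤ Real.exp (p * n ^ 2 / 4) := hB
        _ ≤ Real.exp (-(p / 2 * n) + 0.69 * (p * (n * (n - 1) / 2))) := by
            refine Real.exp_le_exp.2 ?_
            have : 0 ≤ p * (n * (0.095 * n - 0.845) : ℝ) := by
              have : (0 : ℝ) ≤ 0.095 * n - 0.845 := by linarith
              positivity
            linarith
        _ ≤ _ := by rw [Real.exp_add]; gcongr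
    rw [le_div_iff₀ hT0, sub_mul, one_mul]
    have hsplit' := congrArg (Nat.cast : ℕ → ℝ) hsplit
    push_cast at hsplit'
    linarith
  · refine Eventually.of_forall fun n => div_le_one_of_le₀ ?_ (Nat.cast_nonneg _)
    refine Nat.cast_le.2 (Nat.card_mono (Set.toFinite _) ?_)
    rintro R ⟨h1, h2, -⟩
    exact ⟨h1, h2⟩
end

section
/- Let 𝔽 be a field, let M be an n×n matrix over 𝔽 of rank s, and let I ⊆ [n] be such that the principal submatrix M_{I×I} also has rank s. Let T = I×[n] ∪ [n]×I. Then M is the only n×n matrix of rank s that agrees with M on all entries indexed by T; that is, if M' is an n×n matrix over 𝔽 with rank(M') = s and M'_{k,ℓ} = M_{k,ℓ} for all (k,ℓ) ∈ T, then M' = M. -/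
namespace Matrix

variable {K m n m₀ n₀ : Type*} [Field K]

/-- Restricting to a subfamily of columns does not change the column space if it preserves
the rank. -/
theorem range_mulVecLin_submatrix_id [Finite m] [Fintype n] [Fintype n₀] (A : Matrix m n K)
    (f : n₀ → n) (h : A.rank ≤ (A.submatrix id f).rank) :
    LinearMap.range (A.submatrix id f).mulVecLin = LinearMap.range A.mulVecLin := by
  refine Submodule.eq_of_le_of_finrank_le ?_ h
  rw [range_mulVecLin, range_mulVecLin]
  refine Submodule.span_mono ?_
  rintro _ ⟨j, rfl⟩
  exact ⟨f j, rfl⟩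

/-- Restricting to a subfamily of rows does not change the kernel if it preserves the rank. -/
theorem ker_mulVecLin_submatrix_id [Fintype n] (A : Matrix m n K)
    (f : m₀ → m) (h : A.rank ≤ (A.submatrix f id).rank) :
    LinearMap.ker (A.submatrix f id).mulVecLin = LinearMap.ker A.mulVecLin := by
  symm
  refine Submodule.eq_of_le_of_finrank_le ?_ ?_
  · intro v hv
    rw [LinearMap.mem_ker, mulVecLin_apply] at hv ⊢
    ext i
    exact congrFun hv (f i)
  · have h₁ := A.mulVecLin.finrank_range_add_finrank_ker
    have h₂ := (A.submatrix f id).mulVecLin.finrank_range_add_finrank_ker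
    unfold rank at h
    lia

end Matrix

/-- Lemma 4: a matrix of rank `s` containing a rank-`s` tee matrix (with tee shape
`T = I×[n] ∪ [n]×I`) is uniquely determined, among matrices of rank `s`, by its
entries on `T`. -/
theorem eq_of_rank_eq_of_agree_on_tee
    (𝔽 : Type*) [Field 𝔽] (n s : ℕ)
    (M M' : Matrix (Fin n) (Fin n) 𝔽) (I : Finset (Fin n))
    (hM : M.rank = s)
    (hI : (M.submatrix (fun i : I => (i : Fin n)) (fun j : I => (j : Fin n))).rank = s)
    (hM' : M'.rank = s)
    (hT : ∀ k ℓ : Fin n, k ∈ I ∨ ℓ ∈ I → M' k ℓ = M k ℓ) :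
    M' = M := by
  set e : I → Fin n := fun i => i
  set C := M.submatrix id e with hC
  have hC' : M'.submatrix id e = C := by
    ext i j
    exact hT i j (Or.inr j.2)
  have hCI : s ≤ (C.submatrix e id).rank := hI.ge
  have hCs : s ≤ C.rank := hCI.trans (C.rank_submatrix_le e id)
  have hCM : C.rank ≤ s := hM ▸ Matrix.rank_submatrix_le M id e
  have hker := C.ker_mulVecLin_submatrix_id e (hCM.trans hCI)
  have hcol := M.range_mulVecLin_submatrix_id e (hM ▸ hCs)
  have hcol' := M'.range_mulVecLin_submatrix_id e (by rw [hC', hM']; exact hCs)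
  rw [hC'] at hcol'
  ext k ℓ
  obtain ⟨c, hc⟩ : M.col ℓ ∈ LinearMap.range C.mulVecLin := by
    rw [hC, hcol, Matrix.range_mulVecLin]
    exact Submodule.subset_span ⟨ℓ, rfl⟩
  obtain ⟨c', hc'⟩ : M'.col ℓ ∈ LinearMap.range C.mulVecLin := by
    rw [hcol', Matrix.range_mulVecLin]
    exact Submodule.subset_span ⟨ℓ, rfl⟩
  have hmem : c' - c ∈ LinearMap.ker C.mulVecLin := by
    rw [← hker, LinearMap.mem_ker, map_sub, sub_eq_zero]
    ext i
    calc (C.mulVecLin c') (e i) = M' (e i) ℓ := congrFun hc' (e i)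
      _ = M (e i) ℓ := hT _ _ (Or.inl i.2)
      _ = (C.mulVecLin c) (e i) := (congrFun hc (e i)).symm
  rw [LinearMap.mem_ker, map_sub, sub_eq_zero, hc, hc'] at hmem
  exact congrFun hmem k
end

section
/- Let 𝔽 be a field and let M be an n×n matrix over 𝔽 of rank s. Suppose I₁, I₂ ⊆ [n] with |I₁| = |I₂| = s and rank(M_{I₁×I₂}) = s, and set T' = I₁×[n] ∪ [n]×I₂. Then M is the only n×n matrix of rank s agreeing with M on all entries indexed by T': every row of M is the unique linear combination of the rows indexed by I₁ determined by the columns indexed by I₂. -/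
namespace Matrix

variable {m n ι κ 𝔽 : Type*} [Field 𝔽] [Fintype m] [Fintype n] [Fintype ι] [Fintype κ]

/-- If some submatrix on the rows `r` has the same rank as `A`, then every row of `A` is a linear
combination of the rows `r`. -/
lemma exists_vecMul_submatrix_eq_row_of_rank_le (A : Matrix m n 𝔽) (r : ι → m) (c : κ → n)
    (h : A.rank ≤ (A.submatrix r c).rank) (k : m) :
    ∃ x : ι → 𝔽, x ᵥ* A.submatrix r id = A k := by
  have hle : Submodule.span 𝔽 (Set.range (A.submatrix r id).row) ≤
      Submodule.span 𝔽 (Set.range A.row) := by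
    apply Submodule.span_mono
    rintro _ ⟨i, rfl⟩
    exact ⟨r i, rfl⟩
  have hrank : A.rank ≤ (A.submatrix r id).rank :=
    h.trans ((A.submatrix r id).rank_submatrix_le id c)
  have heq := Submodule.eq_of_le_of_finrank_le hle
    (by rwa [← rank_eq_finrank_span_row, ← rank_eq_finrank_span_row])
  have hk : A k ∈ Submodule.span 𝔽 (Set.range (A.submatrix r id).row) :=
    heq ▸ Submodule.subset_span ⟨k, rfl⟩
  rwa [← range_vecMulLinear] at hk

lemma vecMul_injective_of_rank_eq_card (B : Matrix ι κ 𝔽) (h : B.rank = Fintype.card ι) :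
    Function.Injective (fun x => x ᵥ* B) := by
  rw [vecMul_injective_iff, linearIndependent_iff_card_eq_finrank_span, Set.finrank,
    ← rank_eq_finrank_span_row, h]

end Matrix

/-- A rank-`s` matrix with a nonsingular `s×s` submatrix `M_{I₁×I₂}` is uniquely
determined, among matrices of rank `s`, by its entries on `T' = I₁×[n] ∪ [n]×I₂`. -/
theorem eq_of_rank_eq_of_agree_on_cross
    (𝔽 : Type*) [Field 𝔽] (n s : ℕ)
    (M M' : Matrix (Fin n) (Fin n) 𝔽) (I₁ I₂ : Finset (Fin n))
    (hM : M.rank = s) (hI₁ : I₁.card = s) (hI₂ : I₂.card = s)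
    (hr : (M.submatrix (fun i : I₁ => (i : Fin n)) (fun j : I₂ => (j : Fin n))).rank = s)
    (hM' : M'.rank = s)
    (hT : ∀ k ℓ : Fin n, k ∈ I₁ ∨ ℓ ∈ I₂ → M' k ℓ = M k ℓ) :
    M' = M := by
  have hsub : M'.submatrix (fun i : I₁ => (i : Fin n)) (fun j : I₂ => (j : Fin n)) =
      M.submatrix (fun i : I₁ => (i : Fin n)) (fun j : I₂ => (j : Fin n)) := by
    ext i j
    exact hT _ _ (Or.inl i.2)
  have hrows : M'.submatrix (fun i : I₁ => (i : Fin n)) id =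
      M.submatrix (fun i : I₁ => (i : Fin n)) id := by
    ext i j
    exact hT _ _ (Or.inl i.2)
  ext k l
  obtain ⟨x, hx⟩ := M.exists_vecMul_submatrix_eq_row_of_rank_le _ _ (hM.trans hr.symm).le k
  obtain ⟨y, hy⟩ := M'.exists_vecMul_submatrix_eq_row_of_rank_le _ _
    (hM'.trans (hsub ▸ hr).symm).le k
  rw [hrows] at hy
  have hyx : y = x := by
    apply Matrix.vecMul_injective_of_rank_eq_card _ (hr.trans (by simp [hI₁]))
    ext j
    exact (congrFun hy j).trans ((hT k j (Or.inr j.2)).trans (congrFun hx j).symm)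
  rw [← hx, ← hy, hyx]
end

section
/- There is an absolute constant K with the following property. Let 𝔽 be a finite field with F := |𝔽|, and let n, r, m be such that r ≤ n/5 and m ≤ 2r(n−r)/3. Then the number of n×n matrices M over 𝔽 of rank at most r that contain a tee matrix of order 2r, of rank equal to rank(M), and with at most m nonzero entries, is at most K · binom(n, 2r) · binom(2r(n−r), m) · (2F)^m. -/
open Finset
open scoped Matrix

/-- If the submatrix on `f × g` has full rank, every column of `A` is a linear combination of the
columns selected by `g`. -/
theorem Matrix.exists_col_eq_sum_of_rank_submatrix {K m n m₀ n₀ : Type*} [Field K]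
    [Fintype m] [Fintype n] [Fintype n₀] (A : Matrix m n K) (f : m₀ → m) (g : n₀ → n)
    (h : (A.submatrix f g).rank = A.rank) (j : n) :
    ∃ c : n₀ → K, ∀ i, A i j = ∑ l, c l * A i (g l) := by
  have hle : A.rank ≤ (A.submatrix id g).rank := by
    rw [← h]
    exact Matrix.rank_submatrix_le (A.submatrix id g) f id
  have hsub : Submodule.span K (Set.range (A.submatrix id g).col) ≤
      Submodule.span K (Set.range A.col) := by
    apply Submodule.span_mono
    rintro _ ⟨l, rfl⟩
    exact ⟨g l, rfl⟩
  have heq := Submodule.eq_of_le_of_finrank_le hsub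
    (by rwa [← Matrix.rank_eq_finrank_span_cols, ← Matrix.rank_eq_finrank_span_cols])
  have hmem : A.col j ∈ Submodule.span K (Set.range (A.submatrix id g).col) := by
    rw [heq]
    exact Submodule.subset_span ⟨j, rfl⟩
  obtain ⟨c, hc⟩ := (Submodule.mem_span_range_iff_exists_fun K).1 hmem
  refine ⟨c, fun i ↦ ?_⟩
  have := congrFun hc i
  simpa [Matrix.col] using this.symm

/-- A matrix is determined by the rows and columns through a full-rank submatrix. -/
theorem Matrix.eq_of_rank_submatrix_eq {K m n m₀ n₀ : Type*} [Field K]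
    [Fintype m] [Fintype n] [Fintype m₀] [Fintype n₀] {A B : Matrix m n K}
    (f : m₀ → m) (g : n₀ → n)
    (hA : (A.submatrix f g).rank = A.rank) (hB : (B.submatrix f g).rank = B.rank)
    (hrow : ∀ k j, A (f k) j = B (f k) j) (hcol : ∀ i l, A i (g l) = B i (g l)) : A = B := by
  ext i j
  have hA' : (Aᵀ.submatrix g f).rank = Aᵀ.rank := by
    rw [← Matrix.transpose_submatrix, Matrix.rank_transpose, Matrix.rank_transpose, hA]
  obtain ⟨c, hc⟩ := Aᵀ.exists_col_eq_sum_of_rank_submatrix g f hA' i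
  obtain ⟨d, hd⟩ := B.exists_col_eq_sum_of_rank_submatrix f g hB j
  simp only [Matrix.transpose_apply] at hc
  calc A i j = ∑ k, c k * A (f k) j := hc j
    _ = ∑ k, c k * ∑ l, d l * A (f k) (g l) := by simp_rw [hrow, hd]
    _ = ∑ l, d l * ∑ k, c k * A (f k) (g l) := by
      simp_rw [mul_sum]
      rw [sum_comm]
      simp_rw [mul_left_comm]
    _ = B i j := by simp_rw [← hc, hcol, hd]

/-- The pairs `q.1 < q.2` meeting `I`, which index the off-diagonal part of a tee shape up to
transposition. -/
def teePairs {n : ℕ} (I : Finset (Fin n)) : Finset (Fin n × Fin n) :=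
  {q | q.1 < q.2 ∧ (q.1 ∈ I ∨ q.2 ∈ I)}

theorem mem_teePairs {n : ℕ} {I : Finset (Fin n)} {q : Fin n × Fin n} :
    q ∈ teePairs I ↔ q.1 < q.2 ∧ (q.1 ∈ I ∨ q.2 ∈ I) := by
  simp [teePairs]

theorem two_mul_card_teePairs {n : ℕ} (I : Finset (Fin n)) :
    2 * #(teePairs I) + #Iᶜ * #Iᶜ + n = n * n + #Iᶜ := by
  have hunion : (univ : Finset (Fin n)).offDiag =
      (teePairs I ∪ (teePairs I).image Prod.swap) ∪ Iᶜ.offDiag := by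
    ext ⟨a, b⟩
    simp only [mem_offDiag, mem_union, mem_image, mem_teePairs, mem_univ, mem_compl, true_and,
      Prod.exists, Prod.swap_prod_mk, Prod.mk.injEq]
    grind
  have hdisj : Disjoint (teePairs I) ((teePairs I).image Prod.swap) := by
    rw [disjoint_left]
    rintro ⟨a, b⟩ h h'
    simp only [mem_image, mem_teePairs, Prod.exists, Prod.swap_prod_mk, Prod.mk.injEq] at h h'
    grind
  have hdisj' : Disjoint (teePairs I ∪ (teePairs I).image Prod.swap) Iᶜ.offDiag := by
    rw [disjoint_left]
    rintro ⟨a, b⟩ h h'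
    simp only [mem_union, mem_image, mem_teePairs, mem_offDiag, mem_compl, Prod.exists,
      Prod.swap_prod_mk, Prod.mk.injEq] at h h'
    grind
  have hcard := congrArg card hunion
  rw [card_union_of_disjoint hdisj', card_union_of_disjoint hdisj,
    card_image_of_injective _ Prod.swap_injective, offDiag_card, offDiag_card, card_univ,
    Fintype.card_fin] at hcard
  have h1 := Nat.le_mul_self n
  have h2 := Nat.le_mul_self #Iᶜ
  omega

theorem card_teePairs {n r : ℕ} {I : Finset (Fin n)} (hI : #I = 2 * r) :
    #(teePairs I) + r = 2 * r * (n - r) := by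
  have h := two_mul_card_teePairs I
  have hn : #I + #Iᶜ = n := by simp
  obtain ⟨d, hd⟩ : ∃ d, #Iᶜ = d := ⟨_, rfl⟩
  rw [hI, hd] at hn
  have hr : n - r = r + d := by omega
  rw [hd] at h
  rw [hr]
  generalize #(teePairs I) = p at h ⊢
  subst hn
  nlinarith

/-- A pair of field elements at least one of which vanishes, is determined by a bit telling which
entry may be nonzero together with the value of that entry. -/
theorem eq_and_eq_of_mul_eq_zero {K : Type*} [Field K] [DecidableEq K] {a b c d : K}
    (hab : a * b = 0) (hcd : c * d = 0)
    (h : (if a = 0 then (false, b) else (true, a)) = if c = 0 then (false, d) else (true, c)) :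
    a = c ∧ b = d := by
  rw [mul_eq_zero] at hab hcd
  grind

/-- `M` contains a tee matrix with index set `I`, of rank equal to the rank of `M`. -/
def ContainsTee {K : Type*} [Field K] {n : ℕ} (I : Finset (Fin n))
    (M : Matrix (Fin n) (Fin n) K) : Prop :=
  (∀ k, k ∈ I → M k k = 1) ∧
    (∀ k, k ∈ I → ∀ l, k ≠ l → M k l * M l k = 0) ∧
    (M.submatrix (fun i : I => (i : Fin n)) (fun j : I => (j : Fin n))).rank = M.rank

theorem ContainsTee.mul_eq_zero {K : Type*} [Field K] {n : ℕ} {I : Finset (Fin n)}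
    {M : Matrix (Fin n) (Fin n) K} (hM : ContainsTee I M) {q : Fin n × Fin n}
    (hq : q ∈ teePairs I) : M q.1 q.2 * M q.2 q.1 = 0 := by
  obtain ⟨hlt, h | h⟩ := mem_teePairs.1 hq
  · exact hM.2.1 _ h _ hlt.ne
  · rw [mul_comm]
    exact hM.2.1 _ h _ hlt.ne'

theorem ContainsTee.eq_of_eq_on_teePairs {K : Type*} [Field K] {n : ℕ} {I : Finset (Fin n)}
    {A B : Matrix (Fin n) (Fin n) K} (hA : ContainsTee I A) (hB : ContainsTee I B)
    (h : ∀ q ∈ teePairs I, A q.1 q.2 = B q.1 q.2 ∧ A q.2 q.1 = B q.2 q.1) : A = B := by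
  have key : ∀ k l, k ∈ I → A k l = B k l ∧ A l k = B l k := by
    intro k l hk
    rcases lt_trichotomy k l with hkl | rfl | hkl
    · exact h (k, l) (mem_teePairs.2 ⟨hkl, Or.inl hk⟩)
    · rw [hA.1 k hk, hB.1 k hk]
      exact ⟨rfl, rfl⟩
    · exact (h (l, k) (mem_teePairs.2 ⟨hkl, Or.inr hk⟩)).symm
  exact Matrix.eq_of_rank_submatrix_eq _ _ hA.2.2 hB.2.2
    (fun k j ↦ (key k j k.2).1) (fun i l ↦ (key l i l.2).2)

open Classical in
/-- There are at most `(2|K|) ^ |S|` matrices containing a full-rank tee matrix on `I` whose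
off-diagonal part is supported on the pairs in `S`. -/
theorem card_containsTee_support_le {K : Type*} [Field K] [Fintype K] {n : ℕ}
    (I : Finset (Fin n)) (S : Finset (Fin n × Fin n)) :
    #{M : Matrix (Fin n) (Fin n) K | ContainsTee I M ∧
      ∀ q ∈ teePairs I, q ∉ S → M q.1 q.2 = 0 ∧ M q.2 q.1 = 0} ≤ (2 * Fintype.card K) ^ #S := by
  let enc : Matrix (Fin n) (Fin n) K → S → Bool × K := fun M q ↦
    if M q.1.1 q.1.2 = 0 then (false, M q.1.2 q.1.1) else (true, M q.1.1 q.1.2)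
  have hcard : #(univ : Finset (S → Bool × K)) = (2 * Fintype.card K) ^ #S := by
    simp
  rw [← hcard]
  refine card_le_card_of_injOn enc (fun _ _ ↦ mem_coe.2 (mem_univ _)) ?_
  intro A hA B hB hAB
  simp only [coe_filter, mem_univ, true_and, Set.mem_ofPred_eq] at hA hB
  refine hA.1.eq_of_eq_on_teePairs hB.1 fun q hq ↦ ?_
  by_cases hS : q ∈ S
  · exact eq_and_eq_of_mul_eq_zero (hA.1.mul_eq_zero hq) (hB.1.mul_eq_zero hq)
      (congrFun hAB ⟨q, hS⟩)
  · obtain ⟨h1, h2⟩ := hA.2 q hq hS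
    obtain ⟨h3, h4⟩ := hB.2 q hq hS
    exact ⟨h1.trans h3.symm, h2.trans h4.symm⟩

/-- The off-diagonal part of a sparse tee is supported on a set of exactly `m` pairs. -/
theorem exists_support_teePairs {K : Type*} [Field K] {n m : ℕ}
    (I : Finset (Fin n)) (M : Matrix (Fin n) (Fin n) K)
    (hM : Nat.card {q : Fin n × Fin n // (q.1 ∈ I ∨ q.2 ∈ I) ∧ M q.1 q.2 ≠ 0} ≤ m)
    (hm : m ≤ #(teePairs I)) :
    ∃ S ∈ powersetCard m (teePairs I),
      ∀ q ∈ teePairs I, q ∉ S → M q.1 q.2 = 0 ∧ M q.2 q.1 = 0 := by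
  classical
  rw [Nat.card_eq_fintype_card, Fintype.card_subtype] at hM
  set T : Finset (Fin n × Fin n) := {q | (q.1 ∈ I ∨ q.2 ∈ I) ∧ M q.1 q.2 ≠ 0} with hT
  have hcard : #((teePairs I).filter fun q ↦ M q.1 q.2 ≠ 0 ∨ M q.2 q.1 ≠ 0) ≤ m := by
    refine le_trans (card_le_card (t := T.image fun q ↦ (min q.1 q.2, max q.1 q.2)) ?_)
      (card_image_le.trans hM)
    rintro ⟨a, b⟩ hq
    simp only [mem_filter, mem_teePairs] at hq
    obtain ⟨⟨hab, hI⟩, h | h⟩ := hq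
    · exact mem_image.2 ⟨(a, b), by simp [hT, hI, h], by simp [hab.le]⟩
    · exact mem_image.2 ⟨(b, a), by simp [hT, hI.symm, h], by simp [hab.le]⟩
  obtain ⟨S, hS, hSI, hSm⟩ := exists_subsuperset_card_eq (filter_subset _ _) hcard hm
  refine ⟨S, mem_powersetCard.2 ⟨hSI, hSm⟩, fun q hq hqS ↦ ?_⟩
  by_contra hne
  exact hqS (hS (mem_filter.2 ⟨hq, by tauto⟩))


/-- Lemma 5: for `r ≤ n/5` and `m ≤ 2r(n−r)/3`, the number of rank-`≤ r` matrices
over a finite field `𝔽` that contain a tee matrix of order `2r`, of rank equal to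
the rank of the matrix, and with at most `m` nonzeros, is at most
`K·C(n,2r)·C(2r(n−r),m)·(2|𝔽|)^m` for an absolute constant `K`. -/
theorem count_matrices_with_sparse_tee :
    ∃ K : ℝ, 0 < K ∧
      ∀ (𝔽 : Type) [Field 𝔽] [Fintype 𝔽] (n r m : ℕ),
        (r : ℝ) ≤ n / 5 → (m : ℝ) ≤ 2 * r * ((n : ℝ) - r) / 3 →
        (Nat.card {M : Matrix (Fin n) (Fin n) 𝔽 //
            M.rank ≤ r ∧
            ∃ I : Finset (Fin n), I.card = 2 * r ∧
              (∀ k, k ∈ I → M k k = 1) ∧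
              (∀ k, k ∈ I → ∀ ℓ, k ≠ ℓ → M k ℓ * M ℓ k = 0) ∧
              (M.submatrix (fun i : I => (i : Fin n)) (fun j : I => (j : Fin n))).rank
                = M.rank ∧
              Nat.card {q : Fin n × Fin n //
                (q.1 ∈ I ∨ q.2 ∈ I) ∧ M q.1 q.2 ≠ 0} ≤ m} : ℝ)
          ≤ K * (n.choose (2 * r)) * ((2 * r * (n - r)).choose m) *
              (2 * Fintype.card 𝔽) ^ m := by
  classical
  refine ⟨1, one_pos, fun 𝔽 _ _ n r m hr hm ↦ ?_⟩
  have hrn : r ≤ n := by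
    have : (r : ℝ) ≤ n := hr.trans (by linarith [Nat.cast_nonneg (α := ℝ) n])
    exact_mod_cast this
  have hmr : m + r ≤ 2 * r * (n - r) := by
    rw [← Nat.cast_le (α := ℝ)]
    push_cast [hrn]
    rcases Nat.eq_zero_or_pos r with rfl | hpos
    · simp at hm ⊢
      exact hm
    · have : (1 : ℝ) ≤ r := by exact_mod_cast hpos
      nlinarith
  have hcard : ∀ I ∈ powersetCard (2 * r) (univ : Finset (Fin n)),
      m ≤ #(teePairs I) ∧ #(teePairs I) ≤ 2 * r * (n - r) := by
    intro I hI
    have := card_teePairs (mem_powersetCard.1 hI).2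
    omega
  rw [one_mul, Nat.card_eq_fintype_card, Fintype.card_subtype]
  norm_cast
  calc _ ≤ #((powersetCard (2 * r) (univ : Finset (Fin n))).biUnion fun I ↦
          (powersetCard m (teePairs I)).biUnion fun S ↦
            ({M : Matrix (Fin n) (Fin n) 𝔽 | ContainsTee I M ∧
              ∀ q ∈ teePairs I, q ∉ S → M q.1 q.2 = 0 ∧ M q.2 q.1 = 0} : Finset _)) := by
        refine card_le_card fun M hM ↦ ?_
        obtain ⟨-, I, hI, hdiag, hmul, hrank, hsparse⟩ := (mem_filter.1 hM).2
        have hI' : I ∈ powersetCard (2 * r) (univ : Finset (Fin n)) :=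
          mem_powersetCard.2 ⟨subset_univ _, hI⟩
        obtain ⟨S, hS, hzero⟩ := exists_support_teePairs I M hsparse (hcard I hI').1
        exact mem_biUnion.2 ⟨I, hI', mem_biUnion.2 ⟨S, hS,
          mem_filter.2 ⟨mem_univ _, ⟨hdiag, hmul, hrank⟩, hzero⟩⟩⟩
    _ ≤ #(powersetCard (2 * r) (univ : Finset (Fin n))) *
          ((2 * r * (n - r)).choose m * (2 * Fintype.card 𝔽) ^ m) := by
        refine card_biUnion_le_card_mul _ _ _ fun I hI ↦ ?_
        refine (card_biUnion_le_card_mul _ _ ((2 * Fintype.card 𝔽) ^ m) fun S hS ↦ ?_).trans ?_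
        · rw [← (mem_powersetCard.1 hS).2]
          exact card_containsTee_support_le I S
        · rw [card_powersetCard]
          exact Nat.mul_le_mul_right _ (Nat.choose_le_choose m (hcard I hI).2)
    _ = _ := by
        rw [card_powersetCard, card_univ, Fintype.card_fin, ← mul_assoc]
end

section
/- Let 𝔽 be a field, let r and n satisfy 2r ≤ n, and let M be an n×n matrix over 𝔽 with rank(M) ≤ r. Then there exists a subset I ⊆ [n] with |I| = 2r such that the principal submatrix M_{I×I} has rank equal to rank(M). (Consequently, every fooling-set matrix M of rank at most r ≤ n/5 contains a tee matrix of order 2r and rank rank(M).) -/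
/-- There are `M.rank` rows such that every set of rows containing them spans the row space:
`M` factors through the corresponding submatrix. -/
theorem Matrix.exists_finset_card_eq_rank_forall_superset_eq_mul {m n K : Type*} [Fintype m]
    [Fintype n] [Field K] (M : Matrix m n K) :
    ∃ R : Finset m, R.card = M.rank ∧ ∀ I : Finset m, R ⊆ I →
      ∃ A : Matrix m I K, M = A * M.submatrix (fun i : I => (i : m)) id := by
  classical
  obtain ⟨κ, a, ha, hspan, hli⟩ := exists_linearIndependent' K M.row
  have : Fintype κ := Fintype.ofInjective a ha
  refine ⟨Finset.univ.image a, ?_, fun I hI => ?_⟩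
  · rw [Finset.card_image_of_injective _ ha, Finset.card_univ, M.rank_eq_finrank_span_row,
      ← hspan, finrank_span_eq_card hli]
  · have hrow (i : m) : ∃ c : I → K, ∑ j, c j • M.row j = M.row i := by
      rw [← Submodule.mem_span_range_iff_exists_fun]
      refine Submodule.span_mono ?_ (hspan.ge (Submodule.subset_span ⟨i, rfl⟩))
      rintro _ ⟨k, rfl⟩
      exact ⟨⟨a k, hI (Finset.mem_image_of_mem a (Finset.mem_univ k))⟩, rfl⟩
    choose A hA using hrow
    refine ⟨Matrix.of A, ?_⟩
    ext i j
    simpa [Matrix.mul_apply] using (congrFun (hA i) j).symm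

/-- Lemma 6: every `n×n` matrix of rank at most `r` (with `2r ≤ n`) has a principal
submatrix of order `2r` whose rank equals the rank of the whole matrix. -/
theorem exists_principal_submatrix_full_rank
    (𝔽 : Type*) [Field 𝔽] (n r : ℕ) (hrn : 2 * r ≤ n)
    (M : Matrix (Fin n) (Fin n) 𝔽) (hM : M.rank ≤ r) :
    ∃ I : Finset (Fin n), I.card = 2 * r ∧
      (M.submatrix (fun i : I => (i : Fin n)) (fun j : I => (j : Fin n))).rank
        = M.rank := by
  obtain ⟨R, hRcard, hR⟩ := M.exists_finset_card_eq_rank_forall_superset_eq_mul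
  obtain ⟨C, hCcard, hC⟩ := M.transpose.exists_finset_card_eq_rank_forall_superset_eq_mul
  rw [Matrix.rank_transpose] at hCcard
  have hcard : (R ∪ C).card ≤ 2 * r := by
    have := Finset.card_union_le R C
    omega
  obtain ⟨I, hI, hIcard⟩ := Finset.exists_superset_card_eq hcard (by simpa using hrn)
  obtain ⟨A, hA⟩ := hR I (Finset.subset_union_left.trans hI)
  obtain ⟨B, hB⟩ := hC I (Finset.subset_union_right.trans hI)
  refine ⟨I, hIcard, le_antisymm (Matrix.rank_submatrix_le _ _ _) ?_⟩
  have hrows : M.submatrix (fun i : I => (i : Fin n)) id =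
      M.submatrix (fun i : I => (i : Fin n)) (fun j : I => (j : Fin n)) * B.transpose := by
    ext i j
    have := congrFun (congrFun hB j) (i : Fin n)
    simpa [Matrix.mul_apply, mul_comm] using this
  calc M.rank = (A * M.submatrix (fun i : I => (i : Fin n)) id).rank := by rw [← hA]
    _ ≤ (M.submatrix (fun i : I => (i : Fin n)) id).rank := Matrix.rank_mul_le_right _ _
    _ ≤ _ := by
      rw [hrows]
      exact Matrix.rank_mul_le_left _ _
end

section
/- Let 𝔽 be a field and let f_1, …, f_h be polynomials in n variables over 𝔽 with h ≥ n, each of total degree at most d. Then for every m ≥ 0, the number of vectors y ∈ {0,1}^h with Hamming weight at most m for which there exists u ∈ 𝔽^n with y = σ(f(u)) (i.e., y_j = 1 exactly when f_j(u) ≠ 0) is at most binom(n + m·d, n). -/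
open MvPolynomial in
/-- The space of polynomials in `n` variables of total degree at most `N` has dimension at most
`(n + N).choose n`. -/
theorem finrank_restrictTotalDegree_fin_le (𝔽 : Type*) [Field 𝔽] (n N : ℕ) :
    Module.finrank 𝔽 (restrictTotalDegree (Fin n) 𝔽 N) ≤ (n + N).choose n := by
  have hb : Module.finrank 𝔽 (restrictTotalDegree (Fin n) 𝔽 N) =
      Nat.card {s : Fin n →₀ ℕ | (s.sum fun _ e => e) ≤ N} :=
    Module.finrank_eq_nat_card_basis (basisRestrictSupport 𝔽 _)
  have hsum (s : Fin n →₀ ℕ) : (s.sum fun _ e => e) = ∑ i, s i :=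
    Finsupp.sum_fintype _ _ fun _ => rfl
  let e := Sym.equivNatSumOfFintype (Fin (n + 1)) N
  let φ : {s : Fin n →₀ ℕ | (s.sum fun _ e => e) ≤ N} → {P : Fin (n + 1) → ℕ // ∑ i, P i = N} :=
    fun s => ⟨Fin.cons (N - ∑ i, s.1 i) s.1, by
      have h : (s.1.sum fun _ e => e) ≤ N := s.2
      rw [hsum] at h
      simp only [Fin.sum_univ_succ, Fin.cons_zero, Fin.cons_succ]
      omega⟩
  have hφ : Function.Injective φ := by
    intro s t hst
    have h : (Fin.cons (N - ∑ i, s.1 i) s.1 : Fin (n + 1) → ℕ) =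
        Fin.cons (N - ∑ i, t.1 i) t.1 := congrArg Subtype.val hst
    exact Subtype.ext (DFunLike.coe_injective (Fin.cons_injective2 h).2)
  rw [hb]
  refine (Nat.card_le_card_of_injective _ (e.symm.injective.comp hφ)).trans ?_
  rw [Nat.card_eq_fintype_card, Sym.card_sym_eq_choose, Fintype.card_fin,
    show n + 1 + N - 1 = n + N by omega, Nat.choose_symm_add]

/-- Functions `g` indexed by finite sets, with points `u` such that `g i` does not vanish at `u i`
and vanishes at `u j` unless `S i ⊆ S j`, are linearly independent. -/
theorem linearIndependent_of_eval_ne_zero_imp_subset {𝔽 ι α M X : Type*} [Field 𝔽]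
    [AddCommGroup M] [Module 𝔽 M] (S : ι → Finset α) (hS : Function.Injective S)
    (g : ι → M) (ev : X → M →ₗ[𝔽] 𝔽) (u : ι → X) (hdiag : ∀ i, ev (u i) (g i) ≠ 0)
    (hoff : ∀ i j, ev (u j) (g i) ≠ 0 → S i ⊆ S j) : LinearIndependent 𝔽 g := by
  classical
  rw [linearIndependent_iff']
  intro s c hc
  by_contra! hne
  obtain ⟨k, hk, hck⟩ := hne
  obtain ⟨i, hi, hmin⟩ := (s.filter (c · ≠ 0)).exists_min_image (fun i => (S i).card)
    ⟨k, by simp [hk, hck]⟩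
  rw [Finset.mem_filter] at hi
  have h := congrArg (ev (u i)) hc
  rw [map_sum, map_zero, Finset.sum_eq_single_of_mem i hi.1, map_smul, smul_eq_mul,
    mul_eq_zero] at h
  · exact h.elim hi.2 (hdiag i)
  · intro j hj hji
    rw [map_smul, smul_eq_mul]
    by_contra h0
    rw [mul_eq_zero, not_or] at h0
    exact hji (hS (Finset.eq_of_subset_of_card_le (hoff j i h0.2)
      (hmin j (Finset.mem_filter.2 ⟨hj, h0.1⟩))))

/-- Theorem (Rónyai–Babai–Ganapathy): for `h ≥ n` polynomials of degree at most `d`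
in `n` variables, the number of zero-nonzero patterns of Hamming weight at most `m`
is at most `C(n + m·d, n)`. -/
theorem count_zero_nonzero_patterns
    (𝔽 : Type*) [Field 𝔽] (n h d m : ℕ) (hn : n ≤ h)
    (f : Fin h → MvPolynomial (Fin n) 𝔽)
    (hdeg : ∀ j, (f j).totalDegree ≤ d) :
    Nat.card {y : Fin h → Bool //
        (Finset.univ.filter fun j => y j = true).card ≤ m ∧
        ∃ u : Fin n → 𝔽, ∀ j, y j = true ↔ MvPolynomial.eval u (f j) ≠ 0}
      ≤ (n + m * d).choose n := by
  set Y := {y : Fin h → Bool //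
    (Finset.univ.filter fun j => y j = true).card ≤ m ∧
    ∃ u : Fin n → 𝔽, ∀ j, y j = true ↔ MvPolynomial.eval u (f j) ≠ 0}
  choose u hu using fun y : Y => y.2.2
  let S : Y → Finset (Fin h) := fun y => Finset.univ.filter fun j => y.1 j = true
  have hS : Function.Injective S := by
    intro y z hyz
    refine Subtype.ext (funext fun j => Bool.eq_iff_iff.2 ?_)
    simpa [S] using Finset.ext_iff.1 hyz j
  let g : Y → MvPolynomial.restrictTotalDegree (Fin n) 𝔽 (m * d) := fun y =>
    ⟨∏ j ∈ S y, f j, by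
      rw [MvPolynomial.mem_restrictTotalDegree]
      calc (∏ j ∈ S y, f j).totalDegree ≤ ∑ j ∈ S y, (f j).totalDegree :=
            MvPolynomial.totalDegree_finsetProd _ _
        _ ≤ (S y).card * d := Finset.sum_le_card_nsmul _ _ _ fun j _ => hdeg j
        _ ≤ m * d := Nat.mul_le_mul_right d y.2.1⟩
  have heval (y z : Y) : MvPolynomial.aeval (u z) (∏ j ∈ S y, f j) ≠ 0 ↔ S y ⊆ S z := by
    simp [Finset.prod_ne_zero_iff, Finset.subset_iff, S, hu, MvPolynomial.aeval_eq_eval]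
  have hg : LinearIndependent 𝔽 g :=
    linearIndependent_of_eval_ne_zero_imp_subset S hS g
      (fun v => (MvPolynomial.aeval v).toLinearMap ∘ₗ Submodule.subtype _) u
      (fun y => (heval y y).2 subset_rfl) fun y z => (heval y z).1
  have := Fintype.ofFinite Y
  rw [Nat.card_eq_fintype_card]
  exact hg.fintype_card_le_finrank.trans (finrank_restrictTotalDegree_fin_le 𝔽 n (m * d))
end

section
/- Let 𝔽 be a field, let (S, ≤) be a finite partially ordered set, let U be any set, and suppose that for each y ∈ S we are given a function g_y : U → 𝔽 and a point u_y ∈ U such that for all y, z ∈ S: g_y(u_z) ≠ 0 if and only if y ≤ z. Then the family (g_y)_{y ∈ S} is linearly independent in the 𝔽-vector space of functions from U to 𝔽. -/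
/-- Triangular-system lemma from the proof of the Rónyai–Babai–Ganapathy theorem:
if `g_y(u_z) ≠ 0 ⟺ y ≤ z` for all `y, z` in a finite poset `S`, then the family
`(g_y)_{y ∈ S}` of functions `U → 𝔽` is linearly independent. -/
theorem linearIndependent_of_triangular
    (𝔽 : Type*) [Field 𝔽] (S : Type*) [Fintype S] [PartialOrder S]
    (U : Type*) (g : S → U → 𝔽) (u : S → U)
    (h : ∀ y z : S, g y (u z) ≠ 0 ↔ y ≤ z) :
    LinearIndependent 𝔽 g := by
  rw [Fintype.linearIndependent_iff]
  intro c hc z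
  induction z using WellFoundedLT.induction with
  | ind z ih =>
    have hz : ∑ y, c y * g y (u z) = 0 := by simpa using congrFun hc (u z)
    rw [Fintype.sum_eq_single z] at hz
    · exact (mul_eq_zero.mp hz).resolve_right ((h z z).mpr le_rfl)
    · intro y hy
      by_cases hyz : y ≤ z
      · rw [ih y (lt_of_le_of_ne hyz hy), zero_mul]
      · rw [not_not.mp (mt (h y z).mp hyz), mul_zero]
end
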